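/- Let K be an admissible knowledge base. Then the rational closure of K exists and equals the set S of all conditional assertions α |~ β such that either (1) the rank of α (with respect to K) is strictly less than the rank of α ∧ ¬β (where a ranked formula has rank less than a formula with no rank), or (2) α has no rank. -/

import Mathlib

/-- Propositional formulas over a set `V` of propositional variables. -/
inductive Fm (V : Type) : Type
  | var : V → Fm V
  | fls : Fm V
  | tru : Fm V
  | neg : Fm V → Fm V
  | conj : Fm V → Fm V → Fm V
  | disj : Fm V → Fm V → Fm V
  | impl : Fm V → Fm V → Fm V
  | iff : Fm V → Fm V → Fm V

variable {V : Type}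

/-- Truth value of a formula in a world (truth assignment). -/
def Fm.eval (w : V → Bool) : Fm V → Bool
  | .var v => w v
  | .fls => false
  | .tru => true
  | .neg a => !(a.eval w)
  | .conj a b => a.eval w && b.eval w
  | .disj a b => a.eval w || b.eval w
  | .impl a b => !(a.eval w) || b.eval w
  | .iff a b => a.eval w == b.eval w

/-- A formula is valid iff it is satisfied by every world. -/
def Valid (a : Fm V) : Prop := ∀ w : V → Bool, a.eval w = true

/-- A conditional "relation": a set of conditional assertions (pairs of formulas). -/
abbrev CRel (V : Type) := Set (Fm V × Fm V)

/-- Preferential consequence relation: Reflexivity, Left Logical Equivalence,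
Right Weakening, And, Or, Cautious Monotonicity. -/
def IsPreferential (K : CRel V) : Prop :=
  (∀ a, (a, a) ∈ K) ∧
  (∀ a b c, Valid (a.iff b) → (a, c) ∈ K → (b, c) ∈ K) ∧
  (∀ a b c, Valid (a.impl b) → (c, a) ∈ K → (c, b) ∈ K) ∧
  (∀ a b c, (a, b) ∈ K → (a, c) ∈ K → (a, b.conj c) ∈ K) ∧
  (∀ a b c, (a, c) ∈ K → (b, c) ∈ K → (a.disj b, c) ∈ K) ∧
  (∀ a b c, (a, b) ∈ K → (a, c) ∈ K → (a.conj b, c) ∈ K)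

/-- Rational Monotonicity: if α∧β |~/ γ and α |~/ ¬β then α |~/ γ. -/
def RationalMonotonicity (K : CRel V) : Prop :=
  ∀ a b c, (a.conj b, c) ∉ K → (a, b.neg) ∉ K → (a, c) ∉ K

/-- A rational consequence relation is a preferential one satisfying Rational
Monotonicity. -/
def IsRational (K : CRel V) : Prop := IsPreferential K ∧ RationalMonotonicity K

/-- Disjunctive Rationality: if α |~/ γ and β |~/ γ then α∨β |~/ γ. -/
def DisjunctiveRationality (K : CRel V) : Prop :=
  ∀ a b c, (a, c) ∉ K → (b, c) ∉ K → (a.disj b, c) ∉ K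

/-- Negation Rationality: if α∧γ |~/ β and α∧¬γ |~/ β then α |~/ β. -/
def NegationRationality (K : CRel V) : Prop :=
  ∀ a b c, (a.conj c, b) ∉ K → (a.conj c.neg, b) ∉ K → (a, b) ∉ K

/-- `s` is minimal in `A` with respect to the strict order `lt`. -/
def MinIn {S : Type} (lt : S → S → Prop) (A : Set S) (s : S) : Prop :=
  s ∈ A ∧ ∀ t ∈ A, ¬ lt t s

/-- A preferential model: states, labeling by worlds, a strict partial order
satisfying the smoothness condition for each formula. -/
structure PrefModel (V : Type) where
  S : Type
  l : S → V → Bool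
  lt : S → S → Prop
  irrefl : ∀ s, ¬ lt s s
  trans : ∀ s t u, lt s t → lt t u → lt s u
  smooth : ∀ (a : Fm V) (s : S), a.eval (l s) = true →
    MinIn lt {t | a.eval (l t) = true} s ∨
    ∃ t, MinIn lt {t | a.eval (l t) = true} t ∧ lt t s

/-- The model `W` satisfies α |~ β iff every state minimal in α̂ satisfies β. -/
def PrefModel.Sat (W : PrefModel V) (a b : Fm V) : Prop :=
  ∀ s, MinIn W.lt {t | a.eval (W.l t) = true} s → b.eval (W.l s) = true

/-- The consequence relation defined by a preferential model. -/
def PrefModel.Rel (W : PrefModel V) : CRel V := {p | W.Sat p.1 p.2}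

/-- `W` is a model of the knowledge base `K`. -/
def PrefModel.Models (W : PrefModel V) (K : CRel V) : Prop := ∀ p ∈ K, W.Sat p.1 p.2

/-- Preferential entailment: `A` is satisfied by every preferential model of `K`. -/
def Entails (K : CRel V) (A : Fm V × Fm V) : Prop :=
  ∀ W : PrefModel V, W.Models K → W.Sat A.1 A.2

/-- The preferential closure of a knowledge base. -/
def PrefClosure (K : CRel V) : CRel V := {A | Entails K A}

/-- A model is well-founded iff it has no infinite descending chain of states. -/
def PrefModel.NoInfDesc (W : PrefModel V) : Prop :=
  ¬ ∃ f : ℕ → W.S, ∀ n, W.lt (f (n + 1)) (f n)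

/-- A ranked model: the strict order is given by a ranking function into a
totally ordered set. -/
def PrefModel.Ranked (W : PrefModel V) : Prop :=
  ∃ (Ω : Type) (_ : LinearOrder Ω) (r : W.S → Ω), ∀ s t, W.lt s t ↔ r s < r t

/-- α is exceptional for K iff K preferentially entails true |~ ¬α. -/
def Exceptional (K : CRel V) (a : Fm V) : Prop := Entails K (Fm.tru, a.neg)

/-- The set of assertions of K whose antecedent is exceptional for K. -/
def ESet (K : CRel V) : CRel V := {p ∈ K | Exceptional K p.1}

/-- The exceptionality hierarchy: C₀ = K, C_{τ+1} = E(C_τ), intersections at limits. -/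
noncomputable def Cseq (K : CRel V) : Ordinal.{0} → CRel V := fun τ =>
  Ordinal.limitRecOn τ K (fun _ C => ESet C)
    (fun o _ ih => ⋂ ρ : Set.Iio o, ih ρ.1 ρ.2)

/-- α has a rank for K iff it is not exceptional for some C_τ. -/
def HasRank (K : CRel V) (a : Fm V) : Prop := ∃ τ : Ordinal.{0}, ¬ Exceptional (Cseq K τ) a

/-- The rank of α for K: the least τ such that α is not exceptional for C_τ. -/
noncomputable def rnk (K : CRel V) (a : Fm V) : Ordinal.{0} :=
  sInf {τ : Ordinal.{0} | ¬ Exceptional (Cseq K τ) a}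

/-- K is admissible iff every formula with no rank is inconsistent for K. -/
def Admissible (K : CRel V) : Prop :=
  ∀ a : Fm V, ¬ HasRank K a → Entails K (a, Fm.fls)

/-- `α < β in K`: the assertion α∨β |~ ¬β belongs to K. -/
def ltIn (K : CRel V) (a b : Fm V) : Prop := (a.disj b, b.neg) ∈ K

/-- K₀ is preferable to K₁. -/
def Pref (K0 K1 : CRel V) : Prop :=
  (∃ a b, (a, b) ∈ K1 \ K0 ∧
    ∀ c, ltIn K0 c a → ∀ d, (c, d) ∈ K0 → (c, d) ∈ K1) ∧
  (∀ c d, (c, d) ∈ K0 \ K1 → ∃ r e, (r, e) ∈ K1 \ K0 ∧ ltIn K1 r c)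

/-- C is the rational closure of K: a rational extension of K preferable to
every other rational extension of K. -/
def IsRationalClosure (K C : CRel V) : Prop :=
  IsRational C ∧ K ⊆ C ∧ ∀ C', IsRational C' → K ⊆ C' → C' ≠ C → Pref C C'

/-- An assertion α |~ β is supported by K^p iff there is γ with α ⊨ γ and
γ |~ β ∈ K^p. -/
def Supported (K : CRel V) (A : Fm V × Fm V) : Prop :=
  ∃ c : Fm V, Valid (A.1.impl c) ∧ (c, A.2) ∈ PrefClosure K

/-- Classical entailment from the material counterpart of a knowledge base. -/
def MatEntails (K : CRel V) (a : Fm V) : Prop :=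
  ∀ w : V → Bool, (∀ p ∈ K, (p.1.impl p.2).eval w = true) → a.eval w = true

theorem Valid.of_imp {a b : Fm V} (h : ∀ w, a.eval w = true → b.eval w = true) :
    Valid (a.impl b) := by
  intro w
  have := h w
  simp only [Fm.eval]
  grind

namespace IsPreferential

variable {C : CRel V} (hC : IsPreferential C) {a b c d : Fm V}
include hC

theorem refl (a : Fm V) : (a, a) ∈ C := hC.1 a

/-- Left Logical Equivalence, with equivalence expressed worldwise. -/
theorem lle (h : (a, c) ∈ C) (hab : ∀ w, a.eval w = b.eval w) : (b, c) ∈ C :=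
  hC.2.1 a b c (fun w => by simp [Fm.eval, hab w]) h

/-- Right Weakening, using the antecedent as a further premise. -/
theorem weaken (hb : (a, b) ∈ C)
    (h : ∀ w, a.eval w = true → b.eval w = true → c.eval w = true) : (a, c) ∈ C :=
  hC.2.2.1 (a.conj b) c a
    (Valid.of_imp fun w hw => by
      simp only [Fm.eval, Bool.and_eq_true] at hw
      exact h w hw.1 hw.2)
    (hC.2.2.2.1 _ _ _ (hC.refl a) hb)

/-- The material conditional of an assertion follows from any weaker antecedent. -/
theorem impl_of_imp (hb : (a, b) ∈ C) (h : ∀ w, a.eval w = true → d.eval w = true) :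
    (d, a.impl b) ∈ C := by
  have h1 : (a, a.impl b) ∈ C := hC.weaken hb fun w _ hb => by simp [Fm.eval, hb]
  have h2 : (d.conj a.neg, a.impl b) ∈ C :=
    hC.weaken (hC.refl _) fun w _ hw => by
      simp only [Fm.eval] at hw ⊢
      grind
  refine hC.lle (hC.2.2.2.2.1 _ _ _ h1 h2) fun w => ?_
  have := h w
  simp only [Fm.eval]
  grind

/-- Cautious Monotonicity up to equivalence of antecedents. -/
theorem cautious (hb : (a, b) ∈ C) (hc : (a, c) ∈ C)
    (h : ∀ w, (a.conj b).eval w = d.eval w) : (d, c) ∈ C :=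
  hC.lle (hC.2.2.2.2.2 _ _ _ hb hc) h

theorem ltIn_trans (hab : ltIn C a b) (hbc : ltIn C b c) : ltIn C a c := by
  have h1 := hC.impl_of_imp hab (d := a.disj (b.disj c)) fun w hw => by
    simp only [Fm.eval] at hw ⊢; grind
  have h2 := hC.impl_of_imp hbc (d := a.disj (b.disj c)) fun w hw => by
    simp only [Fm.eval] at hw ⊢; grind
  have h3 : (a.disj (b.disj c), a.disj c) ∈ C := hC.weaken h1 fun w h h' => by
    simp only [Fm.eval] at h h' ⊢; grind
  have h4 : (a.disj (b.disj c), c.neg) ∈ C := hC.weaken h2 fun w h h' => by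
    simp only [Fm.eval] at h h' ⊢; grind
  exact hC.cautious h3 h4 fun w => by simp only [Fm.eval]; grind

end IsPreferential

namespace IsRational

variable {C : CRel V} (hC : IsRational C) {a b c d : Fm V}
include hC

/-- Rational Monotonicity up to equivalence of antecedents. -/
theorem monotone (hc : (a, c) ∈ C) (hb : (a, b.neg) ∉ C)
    (h : ∀ w, (a.conj b).eval w = d.eval w) : (d, c) ∈ C :=
  hC.1.lle (by_contra fun h' => hC.2 _ _ _ h' hb hc) h

theorem ltIn_of_not_neg (hab : (b, a.neg) ∉ C) (hbc : ltIn C b c) : ltIn C a c := by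
  have h1 : (a.disj (b.disj c), c.neg) ∈ C :=
    hC.1.weaken (hC.1.impl_of_imp hbc (d := a.disj (b.disj c)) fun w hw => by
      simp only [Fm.eval] at hw ⊢; grind) fun w h h' => by
        simp only [Fm.eval] at h h' ⊢; grind
  refine hC.monotone (b := a.disj c) h1 (fun h2 => hab ?_) fun w => by
    simp only [Fm.eval]; grind
  have h3 : (a.disj (b.disj c), b) ∈ C := hC.1.weaken h2 fun w h h' => by
    simp only [Fm.eval] at h h' ⊢; grind
  have h4 : (a.disj (b.disj c), a.neg) ∈ C := hC.1.weaken h2 fun w h h' => by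
    simp only [Fm.eval] at h h' ⊢; grind
  exact hC.1.cautious h3 h4 fun w => by simp only [Fm.eval]; grind

theorem impl_of_not_ltIn (hab : ¬ ltIn C a b) (h : (a, c) ∈ C) : (b, a.impl c) ∈ C := by
  have h1 := hC.1.impl_of_imp h (d := a.disj b) fun w hw => by
    simp only [Fm.eval] at hw ⊢; grind
  exact hC.monotone (b := b) h1 hab fun w => by simp only [Fm.eval]; grind

end IsRational

theorem Fm.continuous_eval (a : Fm V) : Continuous fun w : V → Bool => a.eval w := by
  induction a with
  | var v => exact continuous_apply v
  | fls => exact continuous_const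
  | tru => exact continuous_const
  | neg a ha => exact (continuous_of_discreteTopology (f := fun x : Bool => !x)).comp ha
  | conj a b ha hb =>
    exact (continuous_of_discreteTopology (f := fun x : Bool × Bool => x.1 && x.2)).comp
      (ha.prodMk hb)
  | disj a b ha hb =>
    exact (continuous_of_discreteTopology (f := fun x : Bool × Bool => x.1 || x.2)).comp
      (ha.prodMk hb)
  | impl a b ha hb =>
    exact (continuous_of_discreteTopology (f := fun x : Bool × Bool => !x.1 || x.2)).comp
      (ha.prodMk hb)
  | iff a b ha hb =>
    exact (continuous_of_discreteTopology (f := fun x : Bool × Bool => x.1 == x.2)).comp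
      (ha.prodMk hb)

/-- A world is normal for `a` if it satisfies all the consequences of `a`. -/
def NormalWorld (C : CRel V) (a : Fm V) (m : V → Bool) : Prop :=
  ∀ b, (a, b) ∈ C → b.eval m = true

theorem IsPreferential.exists_normalWorld {C : CRel V} (hC : IsPreferential C) {a b : Fm V}
    (h : (a, b) ∉ C) : ∃ m, NormalWorld C a m ∧ b.eval m = false := by
  let t : {c // (a, c) ∈ C} → Set (V → Bool) :=
    fun c => {m | c.1.eval m = true} ∩ {m | b.eval m = false}
  have hcl : ∀ c, IsClosed (t c) := fun c =>
    (isClosed_singleton.preimage c.1.continuous_eval).inter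
      (isClosed_singleton.preimage b.continuous_eval)
  have : Nonempty {c // (a, c) ∈ C} := ⟨⟨a, hC.refl a⟩⟩
  obtain ⟨m, hm⟩ := IsCompact.nonempty_iInter_of_directed_nonempty_isCompact_isClosed t
    (fun c d => ⟨⟨c.1.conj d.1, hC.2.2.2.1 _ _ _ c.2 d.2⟩,
      fun m hm => by
        simp only [t, Fm.eval, Set.mem_inter_iff, Set.mem_ofPred_eq, Bool.and_eq_true] at hm ⊢
        tauto,
      fun m hm => by
        simp only [t, Fm.eval, Set.mem_inter_iff, Set.mem_ofPred_eq, Bool.and_eq_true] at hm ⊢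
        tauto⟩)
    (fun c => by
      by_contra hne
      refine h (hC.weaken c.2 fun w _ hw => ?_)
      by_contra hb
      exact hne ⟨w, hw, by simpa using hb⟩)
    (fun c => (hcl c).isCompact) hcl
  rw [Set.mem_iInter] at hm
  exact ⟨m, fun c hc => (hm ⟨c, hc⟩).1, (hm ⟨a, hC.refl a⟩).2⟩

theorem NormalWorld.not_neg_mem {C : CRel V} {a b : Fm V} {m : V → Bool}
    (hm : NormalWorld C a m) (hb : b.eval m = true) : (a, b.neg) ∉ C := fun h => by
  simpa [Fm.eval, hb] using hm _ h

theorem IsPreferential.exists_normalWorld_of_not_neg_mem {C : CRel V} (hC : IsPreferential C)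
    {a b : Fm V} (h : (b, a.neg) ∉ C) : ∃ m, NormalWorld C a m := by
  by_contra hne
  have ha : (a, Fm.fls) ∈ C := by
    by_contra ha
    obtain ⟨m, hm, -⟩ := hC.exists_normalWorld ha
    exact hne ⟨m, hm⟩
  have h1 := hC.impl_of_imp ha (d := a.disj b) fun w hw => by
    simp only [Fm.eval] at hw ⊢; grind
  have h2 : (a.disj b, b) ∈ C := hC.weaken h1 fun w h h' => by
    simp only [Fm.eval] at h h' ⊢; grind
  have h3 : (a.disj b, a.neg) ∈ C := hC.weaken h1 fun w h h' => by
    simp only [Fm.eval] at h h' ⊢; grind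
  exact h (hC.cautious h2 h3 fun w => by simp only [Fm.eval]; grind)

namespace IsRational

variable {C : CRel V}

/-- States of the canonical model: formulas paired with their normal worlds. -/
abbrev NormalState (C : CRel V) : Type :=
  {s : Fm V × (V → Bool) // NormalWorld C s.1 s.2}

/-- The canonical order on normal states. -/
abbrev normalLt (C : CRel V) (s t : NormalState C) : Prop := ltIn C s.1.1 t.1.1

theorem minIn_normalLt_of_not_ltIn (hC : IsRational C) {a : Fm V} {s : NormalState C}
    (hs : a.eval s.1.2 = true) (h : ¬ ltIn C a s.1.1) :
    MinIn (normalLt C) {t | a.eval t.1.2 = true} s :=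
  ⟨hs, fun t ht hts => h (hC.ltIn_of_not_neg (t.2.not_neg_mem ht) hts)⟩

theorem not_ltIn_self {a : Fm V} {m : V → Bool} (hC : IsPreferential C)
    (hm : NormalWorld C a m) : ¬ ltIn C a a := fun h =>
  hm.not_neg_mem (hm a (hC.refl a)) (hC.lle h fun w => by simp [Fm.eval])

theorem exists_minIn_normalLt (hC : IsRational C) {a : Fm V} {s : NormalState C}
    (hs : a.eval s.1.2 = true) (h : ltIn C a s.1.1) :
    ∃ t, MinIn (normalLt C) {t | a.eval t.1.2 = true} t ∧ normalLt C t s := by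
  obtain ⟨m, hm⟩ := hC.1.exists_normalWorld_of_not_neg_mem (s.2.not_neg_mem hs)
  exact ⟨⟨(a, m), hm⟩,
    hC.minIn_normalLt_of_not_ltIn (hm a (hC.1.refl a)) (not_ltIn_self hC.1 hm), h⟩

/-- The canonical model of a rational relation. -/
def normalModel (hC : IsRational C) : PrefModel V where
  S := NormalState C
  l s := s.1.2
  lt := normalLt C
  irrefl s := not_ltIn_self hC.1 s.2
  trans _ _ _ := hC.1.ltIn_trans
  smooth a s hs := by
    by_cases h : ltIn C a s.1.1
    · exact .inr (hC.exists_minIn_normalLt hs h)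
    · exact .inl (hC.minIn_normalLt_of_not_ltIn hs h)

theorem normalModel_sat (hC : IsRational C) {a b : Fm V} :
    hC.normalModel.Sat a b ↔ (a, b) ∈ C := by
  constructor
  · intro h
    by_contra hab
    obtain ⟨m, hm, hb⟩ := hC.1.exists_normalWorld hab
    have := h ⟨(a, m), hm⟩
      (hC.minIn_normalLt_of_not_ltIn (hm a (hC.1.refl a)) (not_ltIn_self hC.1 hm))
    exact Bool.false_ne_true (hb.symm.trans this)
  · rintro h s ⟨hs, hmin⟩
    have h1 : ¬ ltIn C a s.1.1 := fun hlt => by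
      obtain ⟨t, ht, hts⟩ := hC.exists_minIn_normalLt hs hlt
      exact hmin t ht.1 hts
    have h2 := s.2 _ (hC.impl_of_not_ltIn h1 h)
    have h3 : a.eval s.1.2 = true := hs
    have h4 : b.eval s.1.2 = true := by simpa [Fm.eval, h3] using h2
    exact h4

theorem mem_of_entails (hC : IsRational C) {K : CRel V} (hK : K ⊆ C) {p : Fm V × Fm V}
    (h : Entails K p) : p ∈ C :=
  hC.normalModel_sat.1 (h _ fun _ hp => hC.normalModel_sat.2 (hK hp))

end IsRational

/-- Add to a model a bottom level made of the given worlds. -/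
def PrefModel.addBottom (W : PrefModel V) (B : Set (V → Bool)) : PrefModel V where
  S := B ⊕ W.S
  l := Sum.elim (fun m => m.1) W.l
  lt := Sum.Lex (fun _ _ => False) W.lt
  irrefl s h := by
    cases h with
    | inl h => exact h
    | inr h => exact W.irrefl _ h
  trans s t u h h' := by
    cases h with
    | inl h => exact h.elim
    | inr h =>
      cases h' with
      | inr h' => exact .inr (W.trans _ _ _ h h')
    | sep =>
      cases h' with
      | inr h' => exact .sep _ _
  smooth a s hs := by
    by_cases hB : ∃ m ∈ B, a.eval m = true
    · obtain ⟨m, hm, ha⟩ := hB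
      have hmin : ∀ n : B, a.eval n.1 = true →
          MinIn (Sum.Lex (fun _ _ => False) W.lt)
            {t | a.eval (Sum.elim (fun m : B => m.1) W.l t) = true} (.inl n) := by
        refine fun n hn => ⟨hn, fun t _ h => ?_⟩
        cases h with
        | inl h => exact h
      cases s with
      | inl n => exact .inl (hmin n hs)
      | inr s => exact .inr ⟨.inl ⟨m, hm⟩, hmin _ ha, .sep _ _⟩
    · have hmin : ∀ t, MinIn W.lt {t | a.eval (W.l t) = true} t →
          MinIn (Sum.Lex (fun _ _ => False) W.lt)
            {t | a.eval (Sum.elim (fun m : B => m.1) W.l t) = true} (.inr t) := by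
        refine fun t ht => ⟨ht.1, fun u hu h => ?_⟩
        cases h with
        | inr h => exact ht.2 _ hu h
        | sep n => exact hB ⟨n.1, n.2, hu⟩
      cases s with
      | inl n => exact absurd ⟨n.1, n.2, hs⟩ hB
      | inr s =>
        rcases W.smooth a s hs with h | ⟨t, ht, hts⟩
        · exact .inl (hmin s h)
        · exact .inr ⟨.inr t, hmin t ht, .inr hts⟩

theorem PrefModel.addBottom_sat {W : PrefModel V} {B : Set (V → Bool)} {a b : Fm V}
    (hB : ∀ m ∈ B, a.eval m = true → b.eval m = true) (hW : W.Sat a b) :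
    (W.addBottom B).Sat a b := by
  rintro (n | s) ⟨hs, hmin⟩
  · exact hB n.1 n.2 hs
  · exact hW s ⟨hs, fun t ht h => hmin (.inr t) ht (.inr h)⟩

theorem PrefModel.eval_of_addBottom_sat_tru {W : PrefModel V} {B : Set (V → Bool)} {b : Fm V}
    (h : (W.addBottom B).Sat .tru b) {m : V → Bool} (hm : m ∈ B) : b.eval m = true := by
  refine h (.inl ⟨m, hm⟩) ⟨rfl, fun t _ ht => ?_⟩
  cases ht with
  | inl h => exact h

/-- Normal worlds of `c` may be moved to the bottom of a model of `D ⊆ C` as long as no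
antecedent in `D` lies strictly below `c`. -/
theorem IsRational.mem_of_entails_tru_impl {C D : CRel V} (hC : IsRational C) (hD : D ⊆ C)
    {c d : Fm V} (hlt : ∀ p ∈ D, ¬ ltIn C p.1 c) (h : Entails D (.tru, c.impl d)) :
    (c, d) ∈ C := by
  by_contra hcd
  obtain ⟨m, hm, hmd⟩ := hC.1.exists_normalWorld hcd
  have h1 := PrefModel.eval_of_addBottom_sat_tru (B := {n | NormalWorld C c n})
    (h (hC.normalModel.addBottom {n | NormalWorld C c n}) fun p hp =>
      PrefModel.addBottom_sat
        (fun n hn hpn => by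
          simpa [Fm.eval, hpn] using hn _ (hC.impl_of_not_ltIn (hlt p hp) (hD hp)))
        (hC.normalModel_sat.2 (hD hp))) hm
  simp [Fm.eval, hmd, hm c (hC.1.refl c)] at h1

theorem Entails.mono {K K' : CRel V} (h : K ⊆ K') {p : Fm V × Fm V} (hp : Entails K p) :
    Entails K' p := fun W hW => hp W fun q hq => hW q (h hq)

theorem Entails.weaken {K : CRel V} {a b c : Fm V} (h : Entails K (a, b))
    (hbc : ∀ w, b.eval w = true → c.eval w = true) : Entails K (a, c) :=
  fun W hW s hs => hbc _ (h W hW s hs)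

theorem Exceptional.of_imp {K : CRel V} {a b : Fm V} (ha : Exceptional K a)
    (h : ∀ w, b.eval w = true → a.eval w = true) : Exceptional K b :=
  Entails.weaken ha fun w hw => by
    have := h w
    simp only [Fm.eval] at hw ⊢
    grind

theorem Exceptional.of_imp_or {K : CRel V} {a b c : Fm V} (ha : Exceptional K a)
    (hb : Exceptional K b)
    (h : ∀ w, c.eval w = true → a.eval w = true ∨ b.eval w = true) : Exceptional K c := by
  intro W hW s hs
  have h1 := ha W hW s hs
  have h2 := hb W hW s hs
  have h3 := h (W.l s)
  simp only [Fm.eval] at h1 h2 ⊢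
  grind

theorem Exceptional.of_unsat {K : CRel V} {a : Fm V} (h : ∀ w, a.eval w = false) :
    Exceptional K a := fun W _ s _ => by simp [Fm.eval, h (W.l s)]

theorem exceptional_conj_neg_of_mem {K : CRel V} {a b : Fm V} (h : (a, b) ∈ K) :
    Exceptional K (a.conj b.neg) := by
  rintro W hW s ⟨-, hmin⟩
  by_contra hs
  simp only [Fm.eval, Bool.not_eq_true', Bool.not_eq_false, Bool.and_eq_true] at hs
  have := hW _ h s ⟨hs.1, fun t _ => hmin t rfl⟩
  simp [hs.2] at this

theorem mem_Cseq {K : CRel V} (τ : Ordinal.{0}) {p : Fm V × Fm V} :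
    p ∈ Cseq K τ ↔ p ∈ K ∧ ∀ ρ < τ, Exceptional (Cseq K ρ) p.1 := by
  induction τ using Ordinal.limitRecOn with
  | zero => simp [Cseq]
  | add_one τ ih =>
    have : Cseq K (τ + 1) = ESet (Cseq K τ) := by simp [Cseq]
    rw [this]
    simp only [ESet, Set.mem_ofPred_eq, ih, Order.lt_add_one_iff]
    constructor
    · rintro ⟨⟨h, h'⟩, h''⟩
      exact ⟨h, fun ρ hρ => hρ.eq_or_lt.elim (fun e => e ▸ h'') (h' ρ)⟩
    · rintro ⟨h, h'⟩
      exact ⟨⟨h, fun ρ hρ => h' ρ hρ.le⟩, h' τ le_rfl⟩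
  | limit τ hτ ih =>
    have : Cseq K τ = ⋂ ρ : Set.Iio τ, Cseq K ρ.1 := by
      unfold Cseq
      rw [Ordinal.limitRecOn_limit _ _ _ _ hτ]
    rw [this]
    simp only [Set.mem_iInter, Subtype.forall, Set.mem_Iio]
    constructor
    · intro h
      exact ⟨((ih 0 hτ.bot_lt).1 (h 0 hτ.bot_lt)).1, fun ρ hρ =>
        ((ih _ (hτ.add_one_lt hρ)).1 (h _ (hτ.add_one_lt hρ))).2 ρ (lt_add_one ρ)⟩
    · rintro ⟨h, h'⟩ ρ hρ
      exact (ih ρ hρ).2 ⟨h, fun σ hσ => h' σ (hσ.trans hρ)⟩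

theorem Cseq_subset (K : CRel V) (τ : Ordinal.{0}) : Cseq K τ ⊆ K :=
  fun _ hp => ((mem_Cseq τ).1 hp).1

theorem Cseq_antitone (K : CRel V) : Antitone (Cseq K) := fun _ _ h _ hp =>
  (mem_Cseq _).2 ⟨Cseq_subset K _ hp, fun ρ hρ => ((mem_Cseq _).1 hp).2 ρ (hρ.trans_le h)⟩

theorem Exceptional.of_le {K : CRel V} {τ ρ : Ordinal.{0}} (h : τ ≤ ρ) {a : Fm V}
    (ha : Exceptional (Cseq K ρ) a) : Exceptional (Cseq K τ) a :=
  Entails.mono (Cseq_antitone K h) ha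

theorem not_exceptional_rnk {K : CRel V} {a : Fm V} (h : HasRank K a) :
    ¬ Exceptional (Cseq K (rnk K a)) a := csInf_mem (s := {τ | ¬ Exceptional (Cseq K τ) a}) h

theorem exceptional_of_lt_rnk {K : CRel V} {a : Fm V} {τ : Ordinal.{0}} (h : τ < rnk K a) :
    Exceptional (Cseq K τ) a := by
  by_contra h'
  exact notMem_of_lt_csInf' (s := {τ | ¬ Exceptional (Cseq K τ) a}) h h'

theorem rnk_le {K : CRel V} {a : Fm V} {τ : Ordinal.{0}} (h : ¬ Exceptional (Cseq K τ) a) :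
    rnk K a ≤ τ := not_lt.1 fun hlt => h (exceptional_of_lt_rnk hlt)

/-- The set of assertions determined by the ranks of formulas. -/
def rankClosure (K : CRel V) : CRel V :=
  {p : Fm V × Fm V |
    (HasRank K p.1 ∧
      (¬ HasRank K (p.1.conj p.2.neg) ∨
        rnk K p.1 < rnk K (p.1.conj p.2.neg))) ∨
    ¬ HasRank K p.1}

theorem mem_rankClosure {K : CRel V} {a b : Fm V} :
    (a, b) ∈ rankClosure K ↔ ¬ HasRank K a ∨
      ∃ τ, ¬ Exceptional (Cseq K τ) a ∧ Exceptional (Cseq K τ) (a.conj b.neg) := by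
  by_cases ha : HasRank K a
  · simp only [rankClosure, Set.mem_ofPred_eq, ha, true_and, not_true, or_false, false_or]
    constructor
    · intro h
      refine ⟨rnk K a, not_exceptional_rnk ha, ?_⟩
      rcases h with h | h
      · exact not_not.1 (not_exists.1 h _)
      · exact exceptional_of_lt_rnk h
    · rintro ⟨τ, h1, h2⟩
      by_cases hb : HasRank K (a.conj b.neg)
      · refine .inr ((rnk_le h1).trans_lt (lt_of_not_ge fun h => ?_))
        exact not_exceptional_rnk hb (h2.of_le h)
      · exact .inl hb
  · simp [rankClosure, ha]

theorem subset_rankClosure (K : CRel V) : K ⊆ rankClosure K := by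
  rintro ⟨a, b⟩ h
  rw [mem_rankClosure]
  by_cases ha : HasRank K a
  · exact .inr ⟨rnk K a, not_exceptional_rnk ha, exceptional_conj_neg_of_mem
      ((mem_Cseq _).2 ⟨h, fun ρ hρ => exceptional_of_lt_rnk hρ⟩)⟩
  · exact .inl ha

theorem mem_rankClosure_of_imp {K : CRel V} {a b c : Fm V} (h : (a, b) ∈ rankClosure K)
    (hbc : ∀ w, a.eval w = true → b.eval w = true → c.eval w = true) :
    (a, c) ∈ rankClosure K := by
  rw [mem_rankClosure] at h ⊢
  refine h.imp_right fun ⟨τ, h1, h2⟩ => ⟨τ, h1, h2.of_imp fun w => ?_⟩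
  have := hbc w
  simp only [Fm.eval]
  grind

/-- Two assertions with ranked antecedents are witnessed at a common level. -/
theorem exists_common_level {K : CRel V} {a b c d : Fm V} (ha : HasRank K a)
    (hc : HasRank K c) (h : (a, b) ∈ rankClosure K) (h' : (c, d) ∈ rankClosure K) :
    ∃ τ, (¬ Exceptional (Cseq K τ) a ∨ ¬ Exceptional (Cseq K τ) c) ∧
      Exceptional (Cseq K τ) (a.conj b.neg) ∧ Exceptional (Cseq K τ) (c.conj d.neg) := by
  rw [mem_rankClosure] at h h'
  obtain ⟨τ, h1, h2⟩ := h.resolve_left (not_not.2 ha)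
  obtain ⟨ρ, h3, h4⟩ := h'.resolve_left (not_not.2 hc)
  rcases le_total τ ρ with hle | hle
  · exact ⟨τ, .inl h1, h2, h4.of_le hle⟩
  · exact ⟨ρ, .inr h3, h2.of_le hle, h4⟩

theorem HasRank.of_imp {K : CRel V} {a b : Fm V} (ha : HasRank K a)
    (h : ∀ w, a.eval w = true → b.eval w = true) : HasRank K b :=
  ha.imp fun _ h' hb => h' (hb.of_imp h)

theorem isPreferential_rankClosure (K : CRel V) : IsPreferential (rankClosure K) := by
  refine ⟨fun a => ?_, fun a b c hab h => ?_, fun a b c hab h => ?_, fun a b c hb hc => ?_,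
    fun a b c ha hb => ?_, fun a b c hb hc => ?_⟩
  · rw [mem_rankClosure]
    by_cases ha : HasRank K a
    · exact .inr (ha.imp fun τ h => ⟨h, .of_unsat fun w => by simp [Fm.eval]⟩)
    · exact .inl ha
  · have hab' : ∀ w, a.eval w = b.eval w := fun w => by simpa [Fm.eval] using hab w
    rw [mem_rankClosure] at h ⊢
    refine h.imp (mt fun hb => hb.of_imp fun w => by simp [hab' w]) fun ⟨τ, h1, h2⟩ =>
      ⟨τ, mt (fun hb => hb.of_imp fun w => by simp [hab' w]) h1, h2.of_imp fun w => ?_⟩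
    simp [Fm.eval, hab' w]
  · refine mem_rankClosure_of_imp h fun w _ hw => ?_
    have := hab w
    simpa [Fm.eval, hw] using this
  · by_cases ha : HasRank K a
    · obtain ⟨τ, h1, h2, h3⟩ := exists_common_level ha ha hb hc
      refine mem_rankClosure.2 (.inr ⟨τ, or_self_iff.1 h1, h2.of_imp_or h3 fun w => ?_⟩)
      simp only [Fm.eval]
      grind
    · exact mem_rankClosure.2 (.inl ha)
  · by_cases hra : HasRank K a
    · by_cases hrb : HasRank K b
      · obtain ⟨τ, h1, h2, h3⟩ := exists_common_level hra hrb ha hb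
        refine mem_rankClosure.2 (.inr ⟨τ, fun h => h1.elim (fun h1 => h1 (h.of_imp ?_))
          (fun h1 => h1 (h.of_imp ?_)), h2.of_imp_or h3 ?_⟩)
        all_goals
          intro w
          simp only [Fm.eval]
          grind
      · obtain ⟨τ, h1, h2⟩ := (mem_rankClosure.1 ha).resolve_left (not_not.2 hra)
        have h3 := not_not.1 (not_exists.1 hrb τ)
        refine mem_rankClosure.2 (.inr ⟨τ, fun h => h1 (h.of_imp ?_), h2.of_imp_or h3 ?_⟩)
        all_goals
          intro w
          simp only [Fm.eval]
          grind
    · by_cases hrb : HasRank K b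
      · obtain ⟨τ, h1, h2⟩ := (mem_rankClosure.1 hb).resolve_left (not_not.2 hrb)
        have h3 := not_not.1 (not_exists.1 hra τ)
        refine mem_rankClosure.2 (.inr ⟨τ, fun h => h1 (h.of_imp ?_), h2.of_imp_or h3 ?_⟩)
        all_goals
          intro w
          simp only [Fm.eval]
          grind
      · refine mem_rankClosure.2 (.inl ?_)
        rintro ⟨τ, h⟩
        refine h ((not_not.1 (not_exists.1 hra τ)).of_imp_or
          (not_not.1 (not_exists.1 hrb τ)) fun w => ?_)
        simp only [Fm.eval]
        grind
  · by_cases ha : HasRank K a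
    · obtain ⟨τ, h1, h2, h3⟩ := exists_common_level ha ha hb hc
      refine mem_rankClosure.2 (.inr ⟨τ, fun h => or_self_iff.1 h1 (h.of_imp_or h2 ?_),
        h3.of_imp ?_⟩)
      all_goals
        intro w
        simp only [Fm.eval]
        grind
    · exact mem_rankClosure.2 (.inl (mt (fun h => h.of_imp fun w => by
        simp only [Fm.eval]; grind) ha))

theorem isRational_rankClosure (K : CRel V) : IsRational (rankClosure K) := by
  refine ⟨isPreferential_rankClosure K, fun a b c habc hab hac => habc ?_⟩
  rw [mem_rankClosure] at hac hab ⊢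
  push Not at hab
  obtain ⟨τ, h1, h2⟩ := hac.resolve_left (not_not.2 hab.1)
  refine .inr ⟨τ, mt (fun h => h.of_imp fun w => ?_) (hab.2 τ h1), h2.of_imp fun w => ?_⟩
  all_goals
    simp only [Fm.eval]
    grind

/-- For `rankClosure K`, formulas below a ranked formula have strictly smaller rank. -/
theorem rnk_lt_of_ltIn_rankClosure {K : CRel V} {a b : Fm V} (hb : HasRank K b)
    (h : ltIn (rankClosure K) a b) : HasRank K a ∧ rnk K a < rnk K b := by
  obtain ⟨τ, h1, h2⟩ := (mem_rankClosure.1 h).resolve_left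
    (not_not.2 (hb.of_imp fun w => by simp only [Fm.eval]; grind))
  have h3 : Exceptional (Cseq K τ) b := h2.of_imp fun w => by simp only [Fm.eval]; grind
  have h4 : ¬ Exceptional (Cseq K τ) a := fun h => h1 (h.of_imp_or h3 fun w => by
    simp only [Fm.eval]; grind)
  exact ⟨⟨τ, h4⟩, (rnk_le h4).trans_lt
    (lt_of_not_ge fun h => not_exceptional_rnk hb (h3.of_le h))⟩

/-- A failure of `rankClosure K ⊆ C` at antecedent `c` is matched by an assertion of `C`, not in
`rankClosure K`, whose antecedent is below `c` for `C` and has rank at most that of `c`. -/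
theorem exists_mem_diff_of_not_mem {K C : CRel V} (hK : Admissible K) (hC : IsRational C)
    (hKC : K ⊆ C) {c d : Fm V} (hcd : (c, d) ∈ rankClosure K) (hcd' : (c, d) ∉ C) :
    ∃ r, (r, c.neg) ∈ C \ rankClosure K ∧ ltIn C r c ∧ rnk K r ≤ rnk K c := by
  have hc : HasRank K c := by
    by_contra hc
    exact hcd' (hC.1.weaken (hC.mem_of_entails hKC (hK c hc)) fun w _ h => by
      simp [Fm.eval] at h)
  refine by_contra fun hne => hcd' ?_
  obtain ⟨τ, h1, h2⟩ := (mem_rankClosure.1 hcd).resolve_left (not_not.2 hc)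
  refine hC.mem_of_entails_tru_impl ((Cseq_subset K τ).trans hKC) (fun p hp hlt => hne ?_)
    (Entails.weaken h2 fun w => by simp only [Fm.eval]; grind)
  have hr : ¬ Exceptional (Cseq K (rnk K c)) (p.1.disj c) :=
    mt (fun h => h.of_imp fun w => by simp only [Fm.eval]; grind) (not_exceptional_rnk hc)
  refine ⟨p.1.disj c, ⟨hlt, fun h => ?_⟩, hC.1.lle hlt fun w => by
    simp only [Fm.eval]; grind, rnk_le hr⟩
  obtain ⟨⟨_, h3⟩, h4⟩ := rnk_lt_of_ltIn_rankClosure hc h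
  exact not_exceptional_rnk ⟨_, h3⟩ (((mem_Cseq τ).1 hp).2 _ (h4.trans_le (rnk_le h1)))

/-- For an admissible knowledge base K, the rational closure exists and equals
the set of assertions α |~ β such that either rank α < rank (α ∧ ¬β) (including
the case where α ∧ ¬β has no rank) or α has no rank. -/
theorem stmt18 (V : Type) (K : CRel V) (hK : Admissible K) :
    IsRationalClosure K
      {p : Fm V × Fm V |
        (HasRank K p.1 ∧
          (¬ HasRank K (p.1.conj p.2.neg) ∨
            rnk K p.1 < rnk K (p.1.conj p.2.neg))) ∨
        ¬ HasRank K p.1} := by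
  change IsRationalClosure K (rankClosure K)
  refine ⟨isRational_rankClosure K, subset_rankClosure K, fun C hC hKC hne => ⟨?_, ?_⟩⟩
  · let R : Set Ordinal.{0} := {τ | ∃ p ∈ C \ rankClosure K, rnk K p.1 = τ}
    have hR : R.Nonempty := by
      by_contra hR
      have hsub : C ⊆ rankClosure K := fun p hp =>
        by_contra fun hp' => hR ⟨_, p, ⟨hp, hp'⟩, rfl⟩
      refine hne (hsub.antisymm fun p hp => by_contra fun hp' => ?_)
      obtain ⟨r, hr, -⟩ := exists_mem_diff_of_not_mem hK hC hKC hp hp'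
      exact hr.2 (hsub hr.1)
    obtain ⟨⟨a, b⟩, hab, hrank⟩ := csInf_mem hR
    refine ⟨a, b, hab, fun c hca d hcd => by_contra fun hcd' => ?_⟩
    have ha : HasRank K a := by_contra fun ha => hab.2 (mem_rankClosure.2 (.inl ha))
    obtain ⟨r, hr, -, hle⟩ := exists_mem_diff_of_not_mem hK hC hKC hcd hcd'
    have hmin : rnk K a ≤ rnk K r := hrank ▸ csInf_le' ⟨_, hr, rfl⟩
    exact (hmin.trans hle).not_gt (rnk_lt_of_ltIn_rankClosure ha hca).2
  · rintro c d ⟨hcd, hcd'⟩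
    obtain ⟨r, hr, hlt, -⟩ := exists_mem_diff_of_not_mem hK hC hKC hcd hcd'
    exact ⟨r, c.neg, hr, hlt⟩
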